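/- arXiv:2205.06748 — 2 statements merged into one kernel-verified Lean document; each statement's English description precedes it below -/
import Mathlib

section
/- Fix ω ∈ (0,2π), k ∈ ℕ and j ≥ 1. (a) Starting from χ^k_0(z) = z^k on S₋ and ξ^k_0(z₊) = (−1)^k z₊^k on S₊, there exists a sequence of pairs (χ^k_i, ξ^k_i), 1 ≤ i ≤ j, such that each pair solves the primal shadow system: ∂_z∂_{z̄} χ^k_i = χ^k_{i−1} in S₋, ∂_{z₊}∂_{z̄₊} ξ^k_i = 0 in S₊, and on Γ, ∂_z χ^k_i(z) + (∂_{z₊} ξ^k_i)(−z) = 0 and ∂_{z̄} χ^k_i(z) + (∂_{z̄₊} ξ^k_i)(−z) = 0; and the pair (χ^k_j, ξ^k_j) belongs to 𝕊^{k+2j}_{j,j}. (b) Starting from the dual leading term 𝔨^k_0(z) = z^{−k}/(2kπ) if k ≥ 1 and 𝔨^0_0(z) = −log z/(2π), there exists an analogous sequence of dual shadows (ζ^k_i, η^k_i) solving ∂_z∂_{z̄} ζ^k_i = ζ^k_{i−1} in S₋ and ∂_{z₊}∂_{z̄₊} η^k_i = 0 in S₊, with the same Wirtinger transmission conditions on Γ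 when −k+2i ≠ 0, and with the transmission conditions z∂_z ζ^k_i − z̄∂_{z̄} ζ^k_i − z₊∂_{z₊} η^k_i + z̄₊∂_{z̄₊} η^k_i = 0 and ζ^k_i = η^k_i on Γ when −k+2i = 0; the pair (ζ^k_j, η^k_j) belongs to 𝕊^{−k+2j}_{j,j} if −k+2j < 0 and to 𝕊^{−k+2j}_{j,j+1} if −k+2j ≥ 0. -/
open Complex ComplexConjugate Filter Set
open scoped Real

noncomputable section

/-- The Wirtinger derivative `∂_z f = ½(∂_x f − i ∂_y f)`. -/
def wdz (f : ℂ → ℂ) (z : ℂ) : ℂ :=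
  (fderiv ℝ f z 1 - I * fderiv ℝ f z I) / 2

/-- The Wirtinger derivative `∂_{z̄} f = ½(∂_x f + i ∂_y f)`. -/
def wdzbar (f : ℂ → ℂ) (z : ℂ) : ℂ :=
  (fderiv ℝ f z 1 + I * fderiv ℝ f z I) / 2

/-- The open sector `S₋ = {r e^{iθ} : r > 0, |θ| < ω/2}`. -/
def Sminus (ω : ℝ) : Set ℂ := {z | z ≠ 0 ∧ |z.arg| < ω / 2}

/-- The open sector of the variable `z₊ = −z`, i.e. `{z₊ ≠ 0 : |arg z₊| < π − ω/2}`,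
corresponding to the interior of `S₊`. -/
def SplusVar (ω : ℝ) : Set ℂ := {z | z ≠ 0 ∧ |z.arg| < π - ω / 2}

/-- The common boundary `Γ = {r e^{±iω/2} : r > 0}`. -/
def Gam (ω : ℝ) : Set ℂ := {z | z ≠ 0 ∧ |z.arg| = ω / 2}

/-- Membership in `𝕊^{λ,±}_{ℓ,n}` on a domain `D`: a real-linear combination of the
functions `z^{λ−μ} z̄^{μ} log^q z` (for `0 ≤ μ ≤ ℓ`, `0 ≤ q ≤ n`) plus the conjugate
of such a combination. -/
def SbbHalf (lam : ℤ) (ℓ n : ℕ) (D : Set ℂ) (f : ℂ → ℂ) : Prop :=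
  ∃ c d : ℕ → ℕ → ℝ, ∀ z ∈ D,
    f z = (∑ μ ∈ Finset.range (ℓ + 1), ∑ q ∈ Finset.range (n + 1),
            (c μ q : ℂ) * z ^ (lam - μ) * (conj z) ^ μ * (Complex.log z) ^ q)
        + conj (∑ μ ∈ Finset.range (ℓ + 1), ∑ q ∈ Finset.range (n + 1),
            (d μ q : ℂ) * z ^ (lam - μ) * (conj z) ^ μ * (Complex.log z) ^ q)

/-- Membership in `𝕊^{λ}_{ℓ,n}`: a pair `(v, w)` with `v ∈ 𝕊^{λ,−}_{ℓ,n}` on the closed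
sector `|arg z| ≤ ω/2` and `w ∈ 𝕊^{λ,+}_{ℓ,n}` on the closed sector `|arg z₊| ≤ π − ω/2`
(as a function of the variable `z₊ = −z`). -/
def SbbPair (ω : ℝ) (lam : ℤ) (ℓ n : ℕ) (v w : ℂ → ℂ) : Prop :=
  SbbHalf lam ℓ n {z | z ≠ 0 ∧ |z.arg| ≤ ω / 2} v ∧
  SbbHalf lam ℓ n {z | z ≠ 0 ∧ |z.arg| ≤ π - ω / 2} w

open Polynomial

open scoped Classical in
/-- The first-order equation `Q' + c Q = p` is solvable in polynomials; the degree grows only in the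
resonant case `c = 0`. -/
theorem exists_derivative_add_C_mul_eq {K : Type*} [Field K] [CharZero K] (c : K) (p : K[X]) :
    ∃ Q : K[X], derivative Q + C c * Q = p ∧
      Q.natDegree ≤ p.natDegree + (if c = 0 then 1 else 0) := by
  by_cases hc : c = 0
  · refine ⟨∑ n ∈ Finset.range (p.natDegree + 1), C (p.coeff n / (n + 1)) * X ^ (n + 1), ?_, ?_⟩
    · simp only [hc, map_zero, zero_mul, add_zero, derivative_sum]
      conv_rhs => rw [p.as_sum_range_C_mul_X_pow]
      refine Finset.sum_congr rfl fun n _ => ?_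
      have h : (n : K) + 1 ≠ 0 := Nat.cast_add_one_ne_zero n
      rw [derivative_C_mul_X_pow]
      simp [h]
    · rw [if_pos hc]
      refine natDegree_sum_le_of_forall_le _ _ fun n hn => (natDegree_C_mul_X_pow_le _ _).trans ?_
      have := Finset.mem_range.1 hn
      omega
  · suffices H : ∀ d : ℕ, ∀ p : K[X], p.natDegree ≤ d →
        ∃ Q : K[X], derivative Q + C c * Q = p ∧ Q.natDegree ≤ d by
      simpa [hc] using H _ p le_rfl
    have hCc : C c * C c⁻¹ = (1 : K[X]) := by rw [← C_mul, mul_inv_cancel₀ hc, C_1]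
    intro d
    induction d with
    | zero =>
      intro p hp
      refine ⟨C c⁻¹ * p, ?_, (natDegree_C_mul_le _ _).trans hp⟩
      rw [← mul_assoc, hCc, eq_C_of_natDegree_le_zero hp]
      simp
    | succ d ih =>
      intro p hp
      obtain ⟨Q, hQ, hd⟩ := ih (derivative p) ((natDegree_derivative_le p).trans (by omega))
      refine ⟨C c⁻¹ * (p - Q), ?_, (natDegree_C_mul_le _ _).trans
        ((natDegree_sub_le _ _).trans (max_le hp (by omega)))⟩
      rw [derivative_mul, derivative_C, derivative_sub, ← hQ]
      linear_combination (p : K[X]) * hCc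

/-- Every complex polynomial is the sum of two real polynomials evaluated along two distinct
horizontal lines. -/
theorem exists_comp_add_comp_eq {α β : ℝ} (hαβ : α ≠ β) (d : ℕ) (h : ℂ[X]) (hh : h.natDegree ≤ d) :
    ∃ p s : ℝ[X], p.natDegree ≤ d + 1 ∧ s.natDegree ≤ d + 1 ∧
      (p.map (algebraMap ℝ ℂ)).comp (X + C (α * I)) +
        (s.map (algebraMap ℝ ℂ)).comp (X + C (β * I)) = h := by
  suffices H : ∀ d : ℕ, ∀ h : ℂ[X], (∀ n, d ≤ n → h.coeff n = 0) →
      ∃ p s : ℝ[X], p.natDegree ≤ d ∧ s.natDegree ≤ d ∧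
        (p.map (algebraMap ℝ ℂ)).comp (X + C (α * I)) +
          (s.map (algebraMap ℝ ℂ)).comp (X + C (β * I)) = h from
    H (d + 1) h fun n hn => coeff_eq_zero_of_natDegree_lt (by omega)
  intro d
  induction d with
  | zero =>
    intro h hh
    exact ⟨0, 0, by simp, by simp, by ext n; simp [hh n]⟩
  | succ d ih =>
    intro h hh
    set x := (h.coeff d).re with hx
    set A := (h.coeff d).im / ((d + 1) * (α - β)) with hA
    have hd : (d : ℝ) + 1 ≠ 0 := Nat.cast_add_one_ne_zero d
    have hA' : ((h.coeff d).im : ℂ) = A * ((d + 1) * (α - β)) := by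
      have : (h.coeff d).im = A * ((d + 1) * (α - β)) := by
        rw [hA]; field_simp [sub_ne_zero.2 hαβ]
      exact_mod_cast this
    obtain ⟨p, s, hp, hs, hps⟩ := ih
      (h - (C (A : ℂ) * (X + C (α * I)) ^ (d + 1) + C (x : ℂ) * (X + C (α * I)) ^ d
        - C (A : ℂ) * (X + C (β * I)) ^ (d + 1))) (by
      intro n hn
      simp only [coeff_sub, coeff_add, coeff_C_mul, coeff_X_add_C_pow]
      rcases hn.eq_or_lt with rfl | hn
      · have e : h.coeff d = x + (h.coeff d).im * I := (re_add_im _).symm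
        rw [e, hA']
        simp
        ring
      · rw [hh n hn, Nat.choose_eq_zero_of_lt hn]
        rcases (Nat.succ_le_of_lt hn).eq_or_lt with rfl | hn'
        · simp
        · rw [Nat.choose_eq_zero_of_lt hn']
          simp)
    refine ⟨p + (C A * X ^ (d + 1) + C x * X ^ d), s - C A * X ^ (d + 1), ?_, ?_, ?_⟩
    · refine natDegree_add_le_of_degree_le (by omega) (natDegree_add_le_of_degree_le
        (natDegree_C_mul_X_pow_le _ _) ((natDegree_C_mul_X_pow_le _ _).trans (by omega)))
    · exact (natDegree_sub_le _ _).trans (max_le (by omega) (natDegree_C_mul_X_pow_le _ _))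
    · simp only [Polynomial.map_add, Polynomial.map_sub, Polynomial.map_mul, Polynomial.map_pow,
        map_C, map_X, add_comp, sub_comp, mul_comp, pow_comp, C_comp, X_comp, coe_algebraMap]
      linear_combination hps

/-- A sequence obtained by iterating a step which preserves an invariant. -/
theorem exists_seq_of_step {σ : Type*} (P : ℕ → σ → Prop) (R : ℕ → σ → σ → Prop) (x₀ : σ)
    (h₀ : P 0 x₀) (step : ∀ i x, P i x → ∃ y, P (i + 1) y ∧ R i x y) :
    ∃ x : ℕ → σ, x 0 = x₀ ∧ (∀ i, P i (x i)) ∧ ∀ i, R i (x i) (x (i + 1)) := by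
  choose f hf hR using step
  let g : ∀ i, {x // P i x} := fun i => Nat.rec ⟨x₀, h₀⟩ (fun i x => ⟨f i x x.2, hf i x x.2⟩) i
  exact ⟨fun i => (g i).1, rfl, fun i => (g i).2, fun i => hR i (g i).1 (g i).2⟩

/-- `f` is real differentiable at `z` with Wirtinger derivatives `a = ∂_z f` and `b = ∂_{z̄} f`. -/
def HasWirtingerAt (f : ℂ → ℂ) (a b z : ℂ) : Prop :=
  HasFDerivAt f (a • (1 : ℂ →L[ℝ] ℂ) + b • (conjCLE : ℂ →L[ℝ] ℂ)) z

namespace HasWirtingerAt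

variable {f g : ℂ → ℂ} {a b a' b' z : ℂ}

theorem wdz (h : HasWirtingerAt f a b z) : wdz f z = a := by
  rw [_root_.wdz, HasFDerivAt.fderiv h]
  simp
  linear_combination (b / 2 - a / 2) * I_mul_I

theorem wdzbar (h : HasWirtingerAt f a b z) : wdzbar f z = b := by
  rw [_root_.wdzbar, HasFDerivAt.fderiv h]
  simp
  linear_combination (a / 2 - b / 2) * I_mul_I

theorem add (hf : HasWirtingerAt f a b z) (hg : HasWirtingerAt g a' b' z) :
    HasWirtingerAt (fun w => f w + g w) (a + a') (b + b') z := by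
  refine (HasFDerivAt.add hf hg).congr_fderiv ?_
  ext v; simp; ring

theorem mul (hf : HasWirtingerAt f a b z) (hg : HasWirtingerAt g a' b' z) :
    HasWirtingerAt (fun w => f w * g w) (f z * a' + a * g z) (f z * b' + b * g z) z := by
  refine (HasFDerivAt.mul hf hg).congr_fderiv ?_
  ext v; simp; ring

theorem conj_comp (hf : HasWirtingerAt f a b z) :
    HasWirtingerAt (fun w => conj (f w)) (conj b) (conj a) z := by
  refine (HasFDerivAt.comp z (conjCLE : ℂ →L[ℝ] ℂ).hasFDerivAt hf).congr_fderiv ?_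
  ext v; simp; ring

theorem sum {ι : Type*} (s : Finset ι) {F : ι → ℂ → ℂ} {A B : ι → ℂ}
    (h : ∀ i ∈ s, HasWirtingerAt (F i) (A i) (B i) z) :
    HasWirtingerAt (fun w => ∑ i ∈ s, F i w) (∑ i ∈ s, A i) (∑ i ∈ s, B i) z := by
  refine (HasFDerivAt.fun_sum h).congr_fderiv ?_
  ext v; simp [Finset.sum_add_distrib, Finset.sum_mul]

theorem congr_deriv (hf : HasWirtingerAt f a b z) (ha : a = a') (hb : b = b') :
    HasWirtingerAt f a' b' z :=
  ha ▸ hb ▸ hf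

theorem congr_of_eventuallyEq (hf : HasWirtingerAt f a b z) (h : g =ᶠ[nhds z] f) :
    HasWirtingerAt g a b z :=
  HasFDerivAt.congr_of_eventuallyEq hf h

end HasWirtingerAt

theorem HasDerivAt.hasWirtingerAt {f : ℂ → ℂ} {f' z : ℂ} (h : HasDerivAt f f' z) :
    HasWirtingerAt f f' 0 z := by
  refine h.complexToReal_fderiv.congr_fderiv ?_
  simp

/-- The Wirtinger derivatives of a differentiable function are the expected ones. -/
theorem DifferentiableAt.hasWirtingerAt {f : ℂ → ℂ} {z : ℂ} (h : DifferentiableAt ℝ f z) :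
    HasWirtingerAt f (wdz f z) (wdzbar f z) z := by
  refine h.hasFDerivAt.congr_fderiv ?_
  ext v
  have hv : v = v.re + v.im * I := (re_add_im v).symm
  have hc : conj v = v.re - v.im * I := by
    apply Complex.ext <;> simp
  have hD : fderiv ℝ f z v = v.re * fderiv ℝ f z 1 + v.im * fderiv ℝ f z I := by
    have : v = v.re • (1 : ℂ) + v.im • I := by simp
    conv_lhs => rw [this, map_add, map_smul, map_smul]
    simp
  simp only [add_apply, smul_apply, one_apply_eq_self, ContinuousLinearEquiv.coe_coe,
    conjCLE_apply, smul_eq_mul, hc, hD, wdz, wdzbar]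
  linear_combination ((I * fderiv ℝ f z I - fderiv ℝ f z 1) / 2) * hv
    + (v.im * fderiv ℝ f z I) * I_mul_I

/-- The function `z^m p(log z)` for a real polynomial `p`. -/
def zpowLog (m : ℤ) (p : ℝ[X]) (z : ℂ) : ℂ := z ^ m * aeval (log z) p

/-- The function `∑_{μ < n} z^{m-μ} z̄^μ p_μ(log z)`. -/
def logHom (m : ℤ) (n : ℕ) (p : ℕ → ℝ[X]) (z : ℂ) : ℂ :=
  ∑ μ ∈ Finset.range n, zpowLog (m - μ) (p μ) z * conj z ^ μ

/-- The coefficient polynomials of `∂_z` of `logHom m n p`. -/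
def dzCoeff (m : ℤ) (p : ℕ → ℝ[X]) (μ : ℕ) : ℝ[X] :=
  derivative (p μ) + C ((m - μ : ℤ) : ℝ) * p μ

/-- The coefficient polynomials of `∂_{z̄}` of `logHom m n p`. -/
def dzbarCoeff (p : ℕ → ℝ[X]) (μ : ℕ) : ℝ[X] := C (μ + 1 : ℝ) * p (μ + 1)

/-- The sequence `x, a 0, a 1, …`. -/
def consSeq (x : ℝ[X]) (a : ℕ → ℝ[X]) (n : ℕ) : ℝ[X] := Nat.casesOn n x a

theorem hasDerivAt_zpowLog {z : ℂ} (hz : z ∈ slitPlane) (m : ℤ) (p : ℝ[X]) :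
    HasDerivAt (zpowLog m p) (zpowLog (m - 1) (derivative p + C (m : ℝ) * p) z) z := by
  have hz0 := slitPlane_ne_zero hz
  have h1 := hasDerivAt_zpow m z (Or.inl hz0)
  have h2 : HasDerivAt (fun w => aeval (log w) p) _ z :=
    (p.hasDerivAt_aeval (log z)).comp z (hasDerivAt_log hz)
  refine (h1.mul h2).congr_deriv ?_
  have e : z ^ m = z ^ (m - 1) * z := by rw [← zpow_add_one₀ hz0]; simp
  simp only [zpowLog, map_add, map_mul, aeval_C, e]
  simp only [coe_algebraMap, ofReal_intCast]
  field_simp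
  ring

theorem zpowLog_conj {z : ℂ} (hz : z ∈ slitPlane) (m : ℤ) (p : ℝ[X]) :
    zpowLog m p (conj z) = conj (zpowLog m p z) := by
  rw [zpowLog, zpowLog, log_conj z (slitPlane_arg_ne_pi hz), aeval_conj, map_mul, map_zpow₀]

theorem logHom_zero (m : ℤ) (p : ℕ → ℝ[X]) (z : ℂ) : logHom m 0 p z = 0 := by
  simp [logHom]

theorem logHom_succ (m : ℤ) (n : ℕ) (p : ℕ → ℝ[X]) (z : ℂ) :
    logHom m (n + 1) p z =
      zpowLog m (p 0) z + conj z * logHom (m - 1) n (fun μ => p (μ + 1)) z := by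
  rw [logHom, Finset.sum_range_succ', logHom, Finset.mul_sum, add_comm]
  congr 1
  · simp
  · refine Finset.sum_congr rfl fun μ _ => ?_
    rw [show m - 1 - μ = m - (μ + 1 : ℕ) by push_cast; ring]
    ring

theorem logHom_one (m : ℤ) (p : ℕ → ℝ[X]) (z : ℂ) : logHom m 1 p z = zpowLog m (p 0) z := by
  simp [logHom]

theorem hasWirtingerAt_logHom {z : ℂ} (hz : z ∈ slitPlane) (m : ℤ) (n : ℕ) (p : ℕ → ℝ[X]) :
    HasWirtingerAt (logHom m (n + 1) p) (logHom (m - 1) (n + 1) (dzCoeff m p) z)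
      (logHom (m - 1) n (dzbarCoeff p) z) z := by
  have hpow : ∀ μ : ℕ, HasWirtingerAt (fun w => conj w ^ μ) 0 (μ * conj z ^ (μ - 1)) z := by
    intro μ
    have := (hasDerivAt_pow μ z).hasWirtingerAt.conj_comp
    simpa using this
  have h := HasWirtingerAt.sum (Finset.range (n + 1)) fun μ _ =>
    (hasDerivAt_zpowLog hz (m - μ) (p μ)).hasWirtingerAt.mul (hpow μ)
  refine h.congr_deriv ?_ ?_
  · refine Finset.sum_congr rfl fun μ _ => ?_
    rw [show m - 1 - (μ : ℤ) = m - μ - 1 by ring, dzCoeff]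
    simp
  · rw [Finset.sum_range_succ', logHom]
    simp only [CharP.cast_eq_zero, zero_mul, mul_zero, add_zero]
    refine Finset.sum_congr rfl fun μ _ => ?_
    rw [show m - 1 - (μ : ℤ) = m - (μ + 1 : ℕ) by push_cast; ring, dzbarCoeff]
    simp [zpowLog]
    ring

/-- The general element `f + conj g` of the spaces of shadows, with `f` and `g` of type `logHom`. -/
def logPair (m : ℤ) (n : ℕ) (p q : ℕ → ℝ[X]) (z : ℂ) : ℂ :=
  logHom m n p z + conj (logHom m n q z)

/-- The `∂_z` derivative of `logPair m (n + 1) p q`. -/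
def logPairDz (m : ℤ) (n : ℕ) (p q : ℕ → ℝ[X]) (z : ℂ) : ℂ :=
  logHom (m - 1) (n + 1) (dzCoeff m p) z + conj (logHom (m - 1) n (dzbarCoeff q) z)

theorem hasWirtingerAt_logPair {z : ℂ} (hz : z ∈ slitPlane) (m : ℤ) (n : ℕ) (p q : ℕ → ℝ[X]) :
    HasWirtingerAt (logPair m (n + 1) p q) (logPairDz m n p q z)
      (conj (logPairDz m n q p z)) z := by
  refine ((hasWirtingerAt_logHom hz m n p).add
    (hasWirtingerAt_logHom hz m n q).conj_comp).congr_deriv rfl ?_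
  simp [logPairDz, add_comm]

theorem wdzbar_logPair_eventuallyEq {z : ℂ} (hz : z ∈ slitPlane) (m : ℤ) (n : ℕ)
    (p q : ℕ → ℝ[X]) :
    wdzbar (logPair m (n + 1) p q) =ᶠ[nhds z] fun w => conj (logPairDz m n q p w) := by
  filter_upwards [isOpen_slitPlane.mem_nhds hz] with w hw
  exact (hasWirtingerAt_logPair hw m n p q).wdzbar

/-- `∂_z ∂_{z̄}` of a combination with `n + 2` terms. -/
theorem wdz_wdzbar_logPair {z : ℂ} (hz : z ∈ slitPlane) (m : ℤ) (n : ℕ) (p q : ℕ → ℝ[X]) :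
    wdz (wdzbar (logPair m (n + 2) p q)) z =
      logPair (m - 2) (n + 1) (dzCoeff (m - 1) (dzbarCoeff p)) (dzCoeff (m - 1) (dzbarCoeff q))
        z := by
  have h1 := hasWirtingerAt_logHom hz (m - 1) n (dzbarCoeff p)
  have h2 := (hasWirtingerAt_logHom hz (m - 1) (n + 1) (dzCoeff m q)).conj_comp
  have h := ((h1.add h2).congr_of_eventuallyEq (g := wdzbar (logPair m (n + 2) p q)) ?_).wdz
  · rw [h, logPair, show m - 1 - 1 = m - 2 by ring]
    congr 3
    ext1 μ
    simp only [dzCoeff, dzbarCoeff, derivative_mul, derivative_C]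
    rw [show m - ((μ + 1 : ℕ) : ℤ) = m - 1 - μ by push_cast; ring]
    ring
  · refine (wdzbar_logPair_eventuallyEq hz m (n + 1) p q).trans (.of_eq ?_)
    ext w
    simp [logPairDz, add_comm]

theorem wdz_wdzbar_logPair_one {z : ℂ} (hz : z ∈ slitPlane) (m : ℤ) (p q : ℕ → ℝ[X]) :
    wdz (wdzbar (logPair m 1 p q)) z = 0 := by
  have h2 := (hasWirtingerAt_logHom hz (m - 1) 0 (dzCoeff m q)).conj_comp
  have h := (h2.congr_of_eventuallyEq (g := wdzbar (logPair m 1 p q)) ?_).wdz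
  · rw [h]
    simp [logHom_zero]
  · refine (wdzbar_logPair_eventuallyEq hz m 0 p q).trans (.of_eq ?_)
    ext w
    simp [logPairDz, logHom_zero]

/-- Membership of `logPair` in the space `𝕊` follows from degree bounds. -/
theorem sbbHalf_logPair {m : ℤ} {ℓ n : ℕ} {k : ℕ} (hk : k ≤ ℓ) {p q : ℕ → ℝ[X]}
    (hp : ∀ μ ≤ k, (p μ).natDegree ≤ n) (hq : ∀ μ ≤ k, (q μ).natDegree ≤ n) (D : Set ℂ) :
    SbbHalf m ℓ n D (logPair m (k + 1) p q) := by
  have key : ∀ p : ℕ → ℝ[X], (∀ μ ≤ k, (p μ).natDegree ≤ n) → ∀ z,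
      logHom m (k + 1) p z = ∑ μ ∈ Finset.range (ℓ + 1), ∑ r ∈ Finset.range (n + 1),
        (((if μ ≤ k then (p μ).coeff r else 0 : ℝ)) : ℂ) * z ^ (m - μ) * (conj z) ^ μ
          * (log z) ^ r := by
    intro p hp z
    have hsub : Finset.range (k + 1) ⊆ Finset.range (ℓ + 1) := Finset.range_mono (by omega)
    rw [logHom, ← Finset.sum_subset hsub]
    · refine Finset.sum_congr rfl fun μ hμ => ?_
      have hμ' : μ ≤ k := Nat.lt_succ_iff.1 (Finset.mem_range.1 hμ)
      rw [zpowLog, aeval_eq_sum_range' (Nat.lt_succ_of_le (hp μ hμ')), Finset.mul_sum,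
        Finset.sum_mul]
      refine Finset.sum_congr rfl fun r _ => ?_
      rw [if_pos hμ', real_smul]
      ring
    · intro μ _ hμ
      have hμ' : ¬ μ ≤ k := fun h => hμ (Finset.mem_range.2 (Nat.lt_succ_of_le h))
      simp [hμ']
  refine ⟨fun μ r => if μ ≤ k then (p μ).coeff r else 0,
    fun μ r => if μ ≤ k then (q μ).coeff r else 0, fun z _ => ?_⟩
  rw [logPair, key p hp, key q hq]

/-- `u` commutes with conjugation and equals `z^m h(log |z|)` on the ray `arg z = α` for some
complex polynomial `h` of degree at most `d`. -/
def HasTrace (α : ℝ) (m : ℤ) (d : ℕ) (u : ℂ → ℂ) : Prop :=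
  (∀ z ∈ slitPlane, u (conj z) = conj (u z)) ∧
    ∃ h : ℂ[X], h.natDegree ≤ d ∧
      ∀ z : ℂ, z ≠ 0 → z.arg = α → u z = z ^ m * h.eval (Real.log ‖z‖ : ℂ)

theorem log_eq_of_arg_eq {z : ℂ} {α : ℝ} (hα : z.arg = α) :
    log z = Real.log ‖z‖ + α * I := by
  rw [Complex.log, hα]

theorem conj_eq_exp_mul {z : ℂ} {α : ℝ} (hα : z.arg = α) :
    conj z = z * cexp (-(2 * α * I)) := by
  conv_lhs => rw [← norm_mul_exp_arg_mul_I z]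
  conv_rhs => rw [← norm_mul_exp_arg_mul_I z]
  rw [map_mul, ← exp_conj, hα, mul_assoc, ← Complex.exp_add]
  simp
  left
  congr 1
  ring

theorem eval_map_conj (h : ℂ[X]) (x : ℝ) :
    (h.map (starRingEnd ℂ)).eval (x : ℂ) = conj (h.eval (x : ℂ)) := by
  rw [eval_map, ← eval₂_at_apply, conj_ofReal]

theorem aeval_add_mul_I (p : ℝ[X]) (x : ℂ) (α : ℝ) :
    ((p.map (algebraMap ℝ ℂ)).comp (X + C (α * I))).eval x = aeval (x + α * I) p := by
  simp [eval_comp, eval_map_algebraMap]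

theorem natDegree_map_comp_X_add_C_le (p : ℝ[X]) (c : ℂ) :
    ((p.map (algebraMap ℝ ℂ)).comp (X + C c)).natDegree ≤ p.natDegree := by
  rw [natDegree_comp, natDegree_X_add_C, mul_one]
  exact natDegree_map_le

namespace HasTrace

variable {α : ℝ} {m : ℤ} {d : ℕ} {u v : ℂ → ℂ}

theorem add (hu : HasTrace α m d u) (hv : HasTrace α m d v) :
    HasTrace α m d (fun z => u z + v z) := by
  obtain ⟨hu, h, hd, hh⟩ := hu
  obtain ⟨hv, k, kd, hk⟩ := hv
  refine ⟨fun z hz => by beta_reduce; rw [hu z hz, hv z hz, map_add], h + k,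
    natDegree_add_le_of_degree_le hd kd, fun z hz ha => ?_⟩
  beta_reduce
  rw [hh z hz ha, hk z hz ha, eval_add]
  ring

theorem neg (hu : HasTrace α m d u) : HasTrace α m d (fun z => -u z) := by
  obtain ⟨hu, h, hd, hh⟩ := hu
  refine ⟨fun z hz => by beta_reduce; rw [hu z hz, map_neg], -h, by rwa [natDegree_neg], fun z hz ha => ?_⟩
  beta_reduce
  rw [hh z hz ha, eval_neg]
  ring

theorem id_mul (hu : HasTrace α m d u) : HasTrace α (m + 1) d (fun z => z * u z) := by
  obtain ⟨hu, h, hd, hh⟩ := hu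
  refine ⟨fun z hz => by beta_reduce; rw [hu z hz, map_mul], h, hd, fun z hz ha => ?_⟩
  beta_reduce
  rw [hh z hz ha, zpow_add_one₀ hz]
  ring

theorem conj_comp (hu : HasTrace α m d u) : HasTrace α m d (fun z => conj (u z)) := by
  obtain ⟨hu, h, hd, hh⟩ := hu
  refine ⟨fun z hz => by beta_reduce; rw [hu z hz], C (cexp (-(2 * α * I)) ^ m) * h.map (starRingEnd ℂ),
    (natDegree_C_mul_le _ _).trans (natDegree_map_le.trans hd), fun z hz ha => ?_⟩
  beta_reduce
  rw [hh z hz ha, eval_C_mul, eval_map_conj, map_mul, map_zpow₀, conj_eq_exp_mul ha, mul_zpow]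
  ring

theorem zero : HasTrace α m d (fun _ => 0) :=
  ⟨fun z _ => by simp, 0, by simp, fun z _ _ => by simp⟩

theorem conj_mul (hu : HasTrace α m d u) : HasTrace α (m + 1) d (fun z => conj z * u z) := by
  simpa using hu.conj_comp.id_mul.conj_comp

end HasTrace

theorem hasTrace_zpowLog {α : ℝ} (m : ℤ) {d : ℕ} {p : ℝ[X]} (hp : p.natDegree ≤ d) :
    HasTrace α m d (zpowLog m p) := by
  refine ⟨fun z hz => zpowLog_conj hz m p, (p.map (algebraMap ℝ ℂ)).comp (X + C (α * I)),
    (natDegree_map_comp_X_add_C_le _ _).trans hp, fun z _ ha => ?_⟩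
  rw [aeval_add_mul_I, zpowLog, log_eq_of_arg_eq ha]

theorem hasTrace_logHom {α : ℝ} {d : ℕ} (n : ℕ) : ∀ (m : ℤ) {p : ℕ → ℝ[X]},
    (∀ μ < n, (p μ).natDegree ≤ d) → HasTrace α m d (logHom m n p) := by
  induction n with
  | zero =>
    intro m p _
    rw [show logHom m 0 p = fun _ => 0 from funext fun z => logHom_zero m p z]
    exact HasTrace.zero
  | succ n ih =>
    intro m p hp
    rw [show logHom m (n + 1) p = _ from funext fun z => logHom_succ m n p z]
    refine (hasTrace_zpowLog m (hp 0 n.succ_pos)).add ?_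
    have := (ih (m - 1) (p := fun μ => p (μ + 1)) fun μ hμ => hp _ (by omega)).conj_mul (α := α)
    rwa [sub_add_cancel] at this

theorem neg_one_zpow_mul_self (m : ℤ) : (-1 : ℂ) ^ m * (-1 : ℂ) ^ m = 1 := by
  rw [← mul_zpow]; simp

theorem neg_zpow_eq (m : ℤ) (z : ℂ) : (-z) ^ m = (-1 : ℂ) ^ m * z ^ m := by
  rw [← mul_zpow, neg_one_mul]

theorem log_neg_of_arg_eq {z : ℂ} {α : ℝ} (hα : α ∈ Ioo 0 π) (hz : z ≠ 0) (ha : z.arg = α) :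
    log (-z) = Real.log ‖z‖ + (α - π : ℝ) * I := by
  have him : 0 < z.im := by
    have h := norm_mul_sin_arg z
    rw [← h, ha]
    exact mul_pos (norm_pos_iff.2 hz) (Real.sin_pos_of_mem_Ioo hα)
  rw [Complex.log, norm_neg, arg_neg_eq_arg_sub_pi_of_im_pos him, ha]

theorem mem_slitPlane_of_abs_arg {z : ℂ} {α : ℝ} (hα : α < π) (hz : z ≠ 0) (ha : |z.arg| ≤ α) :
    z ∈ slitPlane := by
  refine mem_slitPlane_iff_arg.2 ⟨fun h => ?_, hz⟩
  rw [h, abs_of_pos Real.pi_pos] at ha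
  linarith

theorem neg_mem_slitPlane_of_abs_arg {z : ℂ} {α : ℝ} (hα : α ∈ Ioo 0 π) (hz : z ≠ 0)
    (ha : |z.arg| = α) : -z ∈ slitPlane := by
  refine mem_slitPlane_iff.2 (Or.inr fun h => ?_)
  have h0 : z.im = 0 := by simpa using h
  have := norm_mul_sin_arg z
  rw [h0] at this
  have hs : Real.sin |z.arg| = 0 := by
    rcases abs_choice z.arg with h | h <;> rw [h]
    · exact (mul_eq_zero.1 this).resolve_left (norm_ne_zero_iff.2 hz)
    · rw [Real.sin_neg, (mul_eq_zero.1 this).resolve_left (norm_ne_zero_iff.2 hz), neg_zero]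
  rw [ha] at hs
  exact (Real.sin_pos_of_mem_Ioo hα).ne' hs

/-- An identity which is invariant under conjugation holds on both rays `|arg z| = α` as soon as it
holds on `arg z = α`. -/
theorem eq_zero_of_abs_arg {α : ℝ} (hα : α ∈ Ioo 0 π) {F : ℂ → ℂ}
    (hF : ∀ z, z ∈ slitPlane → -z ∈ slitPlane → F (conj z) = conj (F z))
    (h : ∀ z, z ≠ 0 → z.arg = α → F z = 0) {z : ℂ} (hz : z ≠ 0) (ha : |z.arg| = α) : F z = 0 := by
  have hs := mem_slitPlane_of_abs_arg hα.2 hz ha.le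
  have hs' := neg_mem_slitPlane_of_abs_arg hα hz ha
  rcases (abs_eq hα.1.le).1 ha with ha | ha
  · exact h z hz ha
  · have := h (conj z) (by simpa using hz) (by
      rw [arg_conj, if_neg (slitPlane_arg_ne_pi hs), ha, neg_neg])
    rw [hF z hs hs'] at this
    simpa using this

/-- Solution of a scalar transmission condition on `|arg z| = α`. -/
theorem HasTrace.exists_zpowLog {α : ℝ} (hα : α ∈ Ioo 0 π) {m : ℤ} {d : ℕ} {u : ℂ → ℂ}
    (hu : HasTrace α m d u) :
    ∃ p s : ℝ[X], p.natDegree ≤ d + 1 ∧ s.natDegree ≤ d + 1 ∧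
      ∀ z : ℂ, z ≠ 0 → |z.arg| = α → u z + zpowLog m p z + zpowLog m s (-z) = 0 := by
  obtain ⟨hu, h, hd, hh⟩ := hu
  obtain ⟨p, s, hp, hs, hps⟩ := exists_comp_add_comp_eq (α := α) (β := α - π)
    (by linarith [Real.pi_pos]) d (-h) (by rwa [natDegree_neg])
  refine ⟨p, C ((-1) ^ m) * s, hp, (natDegree_C_mul_le _ _).trans hs, fun z hz ha => ?_⟩
  refine eq_zero_of_abs_arg hα
    (F := fun z => u z + zpowLog m p z + zpowLog m (C ((-1) ^ m) * s) (-z)) ?_ ?_ hz ha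
  · intro z hz hz'
    rw [hu z hz, zpowLog_conj hz, ← map_neg, zpowLog_conj hz', map_add, map_add]
  · intro z hz ha
    have e := congrArg (eval (Real.log ‖z‖ : ℂ)) hps
    rw [eval_add, aeval_add_mul_I, aeval_add_mul_I, eval_neg, ← log_eq_of_arg_eq ha,
      ← log_neg_of_arg_eq hα hz ha] at e
    simp only [zpowLog, hh z hz ha, neg_zpow_eq m z, map_mul, aeval_C]
    simp only [coe_algebraMap, ofReal_zpow, ofReal_neg, ofReal_one]
    linear_combination z ^ m * e + z ^ m * aeval (log (-z)) s * neg_one_zpow_mul_self m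

/-- Solution of the coupled transmission conditions on `|arg z| = α` in the resonant case. -/
theorem HasTrace.exists_aeval_log {α : ℝ} (hα : α ∈ Ioo 0 π) {d : ℕ} {v w : ℂ → ℂ}
    (hv : HasTrace α 0 d v) (hw : HasTrace α 0 d w) :
    ∃ p q s t : ℝ[X], p.natDegree ≤ d + 2 ∧ q.natDegree ≤ d + 2 ∧ s.natDegree ≤ d + 2 ∧
      t.natDegree ≤ d + 2 ∧ ∀ z : ℂ, z ≠ 0 → |z.arg| = α →
        v z + aeval (log z) p + conj (aeval (log z) q)
          - (aeval (log (-z)) s + conj (aeval (log (-z)) t)) = 0 ∧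
        w z + aeval (log z) (derivative p) - conj (aeval (log z) (derivative q))
          - (aeval (log (-z)) (derivative s) - conj (aeval (log (-z)) (derivative t))) = 0 := by
  obtain ⟨hv, h, hd, hh⟩ := hv
  obtain ⟨hw, k, kd, hk⟩ := hw
  have hne : α ≠ α - π := by linarith [Real.pi_pos]
  obtain ⟨H, hH, hHd⟩ := exists_derivative_add_C_mul_eq (0 : ℂ) (C (1 / 2) * (derivative h + k))
  rw [if_pos rfl] at hHd
  have hHd' : H.natDegree ≤ d + 1 := by
    refine hHd.trans (Nat.add_le_add_right ((natDegree_C_mul_le _ _).trans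
      (natDegree_add_le_of_degree_le ((natDegree_derivative_le h).trans (by omega)) kd)) 1)
  obtain ⟨p, s, hp, hs, hps⟩ := exists_comp_add_comp_eq hne (d + 1) (-H) (by rwa [natDegree_neg])
  obtain ⟨q, t, hq, ht, hqt⟩ := exists_comp_add_comp_eq hne (d + 1)
    (-((h - H).map (starRingEnd ℂ))) (by
      rw [natDegree_neg]
      exact natDegree_map_le.trans ((natDegree_sub_le _ _).trans (max_le (by omega) hHd')))
  refine ⟨p, q, -s, -t, hp, hq, by rwa [natDegree_neg], by rwa [natDegree_neg],
    fun z hz ha => ⟨?_, ?_⟩⟩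
  · refine eq_zero_of_abs_arg hα (F := fun z => v z + aeval (log z) p + conj (aeval (log z) q)
          - (aeval (log (-z)) (-s) + conj (aeval (log (-z)) (-t)))) ?_ ?_ hz ha
    · intro z hz hz'
      simp only [hv z hz, ← map_neg conj z, log_conj _ (slitPlane_arg_ne_pi hz),
        log_conj _ (slitPlane_arg_ne_pi hz'), aeval_conj, map_add, map_sub]
    · intro z hz ha
      have e1 := congrArg (eval (Real.log ‖z‖ : ℂ)) hps
      have e2 := congrArg (eval (Real.log ‖z‖ : ℂ)) hqt
      rw [eval_add, aeval_add_mul_I, aeval_add_mul_I, eval_neg, ← log_eq_of_arg_eq ha,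
        ← log_neg_of_arg_eq hα hz ha] at e1 e2
      rw [eval_map_conj, eval_sub] at e2
      have e3 := congrArg conj e2
      simp only [map_add, map_neg, conj_conj] at e3
      simp only [hh z hz ha, map_neg, zpow_zero]
      linear_combination e1 + e3
  · refine eq_zero_of_abs_arg hα (F := fun z => w z + aeval (log z) (derivative p)
          - conj (aeval (log z) (derivative q)) - (aeval (log (-z)) (derivative (-s))
          - conj (aeval (log (-z)) (derivative (-t))))) ?_ ?_ hz ha
    · intro z hz hz'
      simp only [hw z hz, ← map_neg conj z, log_conj _ (slitPlane_arg_ne_pi hz),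
        log_conj _ (slitPlane_arg_ne_pi hz'), aeval_conj, map_add, map_sub]
    · intro z hz ha
      have hdc : ∀ (p : ℝ[X]) (c : ℂ), derivative ((p.map (algebraMap ℝ ℂ)).comp (X + C c)) =
          ((derivative p).map (algebraMap ℝ ℂ)).comp (X + C c) := by
        intro p c
        simp [derivative_comp, derivative_map]
      have e1 := congrArg (fun r => eval (Real.log ‖z‖ : ℂ) (derivative r)) hps
      have e2 := congrArg (fun r => eval (Real.log ‖z‖ : ℂ) (derivative r)) hqt
      have e0 := congrArg (eval (Real.log ‖z‖ : ℂ)) hH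
      simp only [map_zero, zero_mul, add_zero, eval_mul, eval_C, eval_add] at e0
      simp only [derivative_add, hdc] at e1 e2
      rw [eval_add, aeval_add_mul_I, aeval_add_mul_I, ← log_eq_of_arg_eq ha,
        ← log_neg_of_arg_eq hα hz ha] at e1 e2
      rw [derivative_neg, eval_neg] at e1 e2
      rw [derivative_map, eval_map_conj, derivative_sub, eval_sub] at e2
      have e3 := congrArg conj e2
      simp only [map_add, map_neg, conj_conj] at e3
      simp only [hk z hz ha, map_neg, zpow_zero]
      linear_combination e1 - e3 - 2 * e0

theorem natDegree_dzCoeff_le {m : ℤ} {p : ℕ → ℝ[X]} {μ d : ℕ} (h : (p μ).natDegree ≤ d) :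
    (dzCoeff m p μ).natDegree ≤ d :=
  natDegree_add_le_of_degree_le ((natDegree_derivative_le _).trans (by omega))
    ((natDegree_C_mul_le _ _).trans h)

theorem natDegree_dzbarCoeff_le {p : ℕ → ℝ[X]} {μ d : ℕ} (h : (p (μ + 1)).natDegree ≤ d) :
    (dzbarCoeff p μ).natDegree ≤ d :=
  (natDegree_C_mul_le _ _).trans h

theorem hasTrace_logPair {α : ℝ} {m : ℤ} {n d : ℕ} {p q : ℕ → ℝ[X]}
    (hp : ∀ μ < n, (p μ).natDegree ≤ d) (hq : ∀ μ < n, (q μ).natDegree ≤ d) :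
    HasTrace α m d (logPair m n p q) :=
  (hasTrace_logHom n m hp).add (hasTrace_logHom n m hq).conj_comp

theorem hasTrace_logPairDz {α : ℝ} {m : ℤ} {n d : ℕ} {p q : ℕ → ℝ[X]}
    (hp : ∀ μ < n + 1, (p μ).natDegree ≤ d) (hq : ∀ μ < n + 1, (q μ).natDegree ≤ d) :
    HasTrace α (m - 1) d (logPairDz m n p q) :=
  (hasTrace_logHom _ _ fun μ hμ => natDegree_dzCoeff_le (hp μ hμ)).add
    (hasTrace_logHom _ _ fun μ hμ => natDegree_dzbarCoeff_le (hq _ (by omega))).conj_comp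

theorem natDegree_consSeq_zero_le {a : ℕ → ℝ[X]} {n d : ℕ} (ha : ∀ μ ≤ n, (a μ).natDegree ≤ d) :
    ∀ μ < n + 2, (consSeq 0 a μ).natDegree ≤ d
  | 0, _ => by simp [consSeq]
  | μ + 1, h => ha μ (by omega)

theorem logPair_consSeq (m : ℤ) (n : ℕ) (x y : ℝ[X]) (a b : ℕ → ℝ[X]) (z : ℂ) :
    logPair m (n + 1) (consSeq x a) (consSeq y b) z =
      logPair m (n + 1) (consSeq 0 a) (consSeq 0 b) z + zpowLog m x z
        + conj (zpowLog m y z) := by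
  simp only [logPair, logHom_succ, map_add]
  simp [consSeq, zpowLog]
  ring

theorem logPairDz_consSeq (m : ℤ) (n : ℕ) (x y : ℝ[X]) (a b : ℕ → ℝ[X]) (z : ℂ) :
    logPairDz m n (consSeq x a) (consSeq y b) z =
      logPairDz m n (consSeq 0 a) (consSeq 0 b) z
        + zpowLog (m - 1) (derivative x + C (m : ℝ) * x) z := by
  have e : dzbarCoeff (consSeq y b) = dzbarCoeff (consSeq 0 b) := rfl
  have e' : (fun μ => dzCoeff m (consSeq x a) (μ + 1)) =
    fun μ => dzCoeff m (consSeq 0 a) (μ + 1) := rfl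
  have e0 : dzCoeff m (consSeq x a) 0 = derivative x + C (m : ℝ) * x := by
    simp [dzCoeff, consSeq]
  have e0' : dzCoeff m (consSeq 0 a) 0 = 0 := by simp [dzCoeff, consSeq]
  simp only [logPairDz, logHom_succ, e, e', e0, e0']
  simp only [zpowLog, map_zero, mul_zero]
  ring

theorem logPairDz_const (m : ℤ) (s t : ℝ[X]) (z : ℂ) :
    logPairDz m 0 (fun _ => s) (fun _ => t) z =
      zpowLog (m - 1) (derivative s + C (m : ℝ) * s) z := by
  simp [logPairDz, logHom_zero, logHom_one, dzCoeff]

theorem mul_zpowLog_neg_one {z : ℂ} (hz : z ≠ 0) (p : ℝ[X]) :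
    z * zpowLog (-1) p z = aeval (log z) p := by
  simp [zpowLog, hz]

/-- The transmission conditions on `|arg z| = α` in degree of homogeneity `m`, for the pair made of
`v = logPair m (n + 1) a b` and the harmonic function `w = z^m s(log z) + conj (z^m t(log z))`. -/
def Transmission (α : ℝ) (m : ℤ) (n : ℕ) (a b : ℕ → ℝ[X]) (s t : ℝ[X]) : Prop :=
  ∀ z : ℂ, z ≠ 0 → |z.arg| = α →
    (m ≠ 0 →
      logPairDz m n a b z + logPairDz m 0 (fun _ => s) (fun _ => t) (-z) = 0 ∧
      conj (logPairDz m n b a z) + conj (logPairDz m 0 (fun _ => t) (fun _ => s) (-z)) = 0) ∧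
    (m = 0 →
      z * logPairDz m n a b z - conj z * conj (logPairDz m n b a z)
        - (-z) * logPairDz m 0 (fun _ => s) (fun _ => t) (-z)
        + conj (-z) * conj (logPairDz m 0 (fun _ => t) (fun _ => s) (-z)) = 0 ∧
      logPair m (n + 1) a b z = logPair m 1 (fun _ => s) (fun _ => t) (-z))

/-- Any combination can be corrected by harmonic terms so that the transmission conditions hold. -/
theorem exists_transmission {α : ℝ} (hα : α ∈ Ioo 0 π) (m : ℤ) {n d : ℕ} {a b : ℕ → ℝ[X]}
    (ha : ∀ μ ≤ n, (a μ).natDegree ≤ d) (hb : ∀ μ ≤ n, (b μ).natDegree ≤ d) :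
    ∃ x y s t : ℝ[X], (∀ r ∈ [x, y, s, t], r.natDegree ≤ d + 1 + (if m = 0 then 1 else 0)) ∧
      Transmission α m (n + 1) (consSeq x a) (consSeq y b) s t := by
  have ha' := natDegree_consSeq_zero_le ha
  have hb' := natDegree_consSeq_zero_le hb
  by_cases hm : m = 0
  · subst hm
    have h1 := (hasTrace_logPairDz (α := α) (m := 0) ha' hb').id_mul
    have h2 := (hasTrace_logPairDz (α := α) (m := 0) hb' ha').id_mul.conj_comp.neg
    obtain ⟨x, y, s, t, hx, hy, hs, ht, H⟩ :=
      (hasTrace_logPair (α := α) (m := 0) ha' hb').exists_aeval_log hα (h1.add h2)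
    refine ⟨x, y, s, t, by simp [hx, hy, hs, ht], fun z hz hza => ⟨by simp, fun _ => ?_⟩⟩
    obtain ⟨H1, H2⟩ := H z hz hza
    constructor
    · have e : ∀ (u : ℂ) (p : ℝ[X]), u ≠ 0 →
          u * zpowLog (0 - 1) (derivative p + C ((0 : ℤ) : ℝ) * p) u
            = aeval (log u) (derivative p) := by
        intro u p hu
        rw [← mul_zpowLog_neg_one hu]
        simp
      have hz' : -z ≠ 0 := neg_ne_zero.2 hz
      rw [logPairDz_consSeq 0 _ x, logPairDz_consSeq 0 _ y, logPairDz_const, logPairDz_const]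
      have e2 := congrArg conj (e z y hz)
      have e4 := congrArg conj (e (-z) t hz')
      simp only [map_mul] at e2 e4
      simp only [map_mul] at H2
      simp only [map_add]
      linear_combination H2 + e z x hz - e2 - e (-z) s hz' + e4
    · rw [logPair_consSeq]
      simp only [logPair, logHom_one, zpowLog, zpow_zero, one_mul] at H1 ⊢
      linear_combination H1
  · obtain ⟨x₁, s₁, hx₁, hs₁, H₁⟩ :=
      (hasTrace_logPairDz (α := α) (m := m) ha' hb').exists_zpowLog hα
    obtain ⟨y₁, t₁, hy₁, ht₁, H₂⟩ :=
      (hasTrace_logPairDz (α := α) (m := m) hb' ha').exists_zpowLog hα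
    have hmR : (m : ℝ) ≠ 0 := by exact_mod_cast hm
    obtain ⟨x, hx, dx⟩ := exists_derivative_add_C_mul_eq (m : ℝ) x₁
    obtain ⟨y, hy, dy⟩ := exists_derivative_add_C_mul_eq (m : ℝ) y₁
    obtain ⟨s, hs, ds⟩ := exists_derivative_add_C_mul_eq (m : ℝ) s₁
    obtain ⟨t, ht, dt⟩ := exists_derivative_add_C_mul_eq (m : ℝ) t₁
    rw [if_neg hmR] at dx dy ds dt
    refine ⟨x, y, s, t, ?_, fun z hz hza => ⟨fun _ => ⟨?_, ?_⟩, fun h => absurd h hm⟩⟩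
    · simp only [List.forall_mem_cons, List.not_mem_nil, if_neg hm]
      refine ⟨by omega, by omega, by omega, by omega, by simp⟩
    · rw [logPairDz_consSeq, logPairDz_const, hx, hs]
      exact H₁ z hz hza
    · rw [logPairDz_consSeq, logPairDz_const, hy, ht, ← map_add]
      exact (congrArg conj (H₂ z hz hza)).trans (map_zero _)

/-- A right inverse of `∂_z ∂_{z̄}` on the coefficient polynomials. -/
theorem exists_dzCoeff_dzbarCoeff_eq (m : ℤ) (p : ℕ → ℝ[X]) :
    ∃ a : ℕ → ℝ[X], (∀ x, dzCoeff (m - 1) (dzbarCoeff (consSeq x a)) = p) ∧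
      ∀ μ : ℕ, (a μ).natDegree ≤ (p μ).natDegree + (if m - 1 - μ = 0 then 1 else 0) := by
  choose Q hQ dQ using fun μ : ℕ =>
    exists_derivative_add_C_mul_eq (((m - 1 - μ : ℤ)) : ℝ) (p μ)
  refine ⟨fun μ => C ((μ + 1 : ℝ)⁻¹) * Q μ, fun x => ?_, fun μ => ?_⟩
  · ext1 μ
    have h : (μ : ℝ) + 1 ≠ 0 := Nat.cast_add_one_ne_zero μ
    have e : dzbarCoeff (consSeq x fun μ => C ((μ + 1 : ℝ)⁻¹) * Q μ) μ = Q μ := by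
      simp only [dzbarCoeff, consSeq]
      rw [← mul_assoc, ← C_mul, mul_inv_cancel₀ h, C_1, one_mul]
    rw [dzCoeff, e, hQ]
  · refine (natDegree_C_mul_le _ _).trans ((dQ μ).trans ?_)
    simp only [Int.cast_eq_zero]
    split_ifs <;> simp

/-- Degree bounds for the coefficients of the shadow of order `i` with leading exponent `m`. -/
def DegreeBound (δ : ℤ → ℕ) (m : ℤ) (i : ℕ) (p : ℕ → ℝ[X]) : Prop :=
  ∀ μ ≤ i, (p μ).natDegree ≤ i - μ + δ (m + 2 * i - μ)

theorem DegreeBound.le {δ : ℤ → ℕ} (hδ : Monotone δ) {m : ℤ} {i : ℕ} {p : ℕ → ℝ[X]}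
    (h : DegreeBound δ m i p) : ∀ μ ≤ i, (p μ).natDegree ≤ i + δ (m + 2 * i) := fun μ hμ =>
  (h μ hμ).trans (Nat.add_le_add (Nat.sub_le _ _) (hδ (by omega)))

/-- Recursive construction of the coefficients of shadows of all orders. -/
theorem exists_shadow_coeffs {α : ℝ} (hα : α ∈ Ioo 0 π) (m : ℤ) {δ : ℤ → ℕ} (hδ : Monotone δ)
    (hres : 0 ≤ m ∨ δ (-1) + 1 ≤ δ 0) {p₀ : ℝ[X]} (hp₀ : p₀.natDegree ≤ δ m) :
    ∃ (p q : ℕ → ℕ → ℝ[X]) (s t : ℕ → ℝ[X]), p 0 = (fun _ => p₀) ∧ q 0 = (fun _ => 0) ∧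
      (∀ i, DegreeBound δ m i (p i) ∧ DegreeBound δ m i (q i)) ∧
      ∀ i : ℕ, dzCoeff (m + 2 * (i + 1 : ℕ) - 1) (dzbarCoeff (p (i + 1))) = p i ∧
        dzCoeff (m + 2 * (i + 1 : ℕ) - 1) (dzbarCoeff (q (i + 1))) = q i ∧
        (s (i + 1)).natDegree ≤ (i + 1) + δ (m + 2 * (i + 1 : ℕ)) ∧
        (t (i + 1)).natDegree ≤ (i + 1) + δ (m + 2 * (i + 1 : ℕ)) ∧
        Transmission α (m + 2 * (i + 1 : ℕ)) (i + 1) (p (i + 1)) (q (i + 1))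
          (s (i + 1)) (t (i + 1)) := by
  refine Exists.elim (exists_seq_of_step
    (σ := (ℕ → ℝ[X]) × (ℕ → ℝ[X]) × ℝ[X] × ℝ[X])
    (fun i x => DegreeBound δ m i x.1 ∧ DegreeBound δ m i x.2.1)
    (fun i x y => dzCoeff (m + 2 * (i + 1 : ℕ) - 1) (dzbarCoeff y.1) = x.1 ∧
        dzCoeff (m + 2 * (i + 1 : ℕ) - 1) (dzbarCoeff y.2.1) = x.2.1 ∧
        y.2.2.1.natDegree ≤ (i + 1) + δ (m + 2 * (i + 1 : ℕ)) ∧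
        y.2.2.2.natDegree ≤ (i + 1) + δ (m + 2 * (i + 1 : ℕ)) ∧
        Transmission α (m + 2 * (i + 1 : ℕ)) (i + 1) y.1 y.2.1 y.2.2.1 y.2.2.2)
    (fun _ => p₀, fun _ => 0, 0, 0)
    ⟨fun μ hμ => by simpa [Nat.le_zero.1 hμ] using hp₀, fun μ _ => by simp⟩ ?_) ?_
  on_goal 2 =>
    rintro x ⟨hx₀, hinv, hrel⟩
    exact ⟨fun i => (x i).1, fun i => (x i).2.1, fun i => (x i).2.2.1, fun i => (x i).2.2.2,
      congrArg (fun x => x.1) hx₀, congrArg (fun x => x.2.1) hx₀, hinv, hrel⟩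
  rintro i ⟨p, q, _, _⟩ ⟨hp, hq⟩
  dsimp only at hp hq ⊢
  set M : ℤ := m + 2 * (i + 1 : ℕ) with hM
  have bound : ∀ {p a : ℕ → ℝ[X]}, DegreeBound δ m i p →
      (∀ μ : ℕ, (a μ).natDegree ≤ (p μ).natDegree + (if M - 1 - μ = 0 then 1 else 0)) →
      ∀ μ ≤ i, (a μ).natDegree ≤ i - μ + δ (M - 1 - μ) := by
    intro p a hp ha μ hμ
    refine (ha μ).trans ?_
    have h1 := hp μ hμ
    split_ifs with h
    · have h2 : m + 2 * i - μ = -1 := by push_cast at hM; omega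
      have h3 : δ (-1) + 1 ≤ δ 0 := hres.resolve_left (by push_cast at hM; omega)
      rw [h2] at h1
      rw [h]
      omega
    · have h2 : δ (m + 2 * i - μ) ≤ δ (M - 1 - μ) := hδ (by push_cast at hM; omega)
      omega
  obtain ⟨a, ha, da⟩ := exists_dzCoeff_dzbarCoeff_eq M p
  obtain ⟨b, hb, db⟩ := exists_dzCoeff_dzbarCoeff_eq M q
  have da' := bound hp da
  have db' := bound hq db
  have low : ∀ {a : ℕ → ℝ[X]}, (∀ μ ≤ i, (a μ).natDegree ≤ i - μ + δ (M - 1 - μ)) →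
      ∀ μ ≤ i, (a μ).natDegree ≤ i + δ (M - 1) := fun h μ hμ =>
    (h μ hμ).trans (Nat.add_le_add (Nat.sub_le _ _) (hδ (by omega)))
  obtain ⟨x, y, s, t, hxy, hT⟩ := exists_transmission hα M (low da') (low db')
  have top : i + δ (M - 1) + 1 + (if M = 0 then 1 else 0) ≤ i + 1 + δ M := by
    split_ifs with h
    · have h3 : δ (-1) + 1 ≤ δ 0 := hres.resolve_left (by push_cast at hM; omega)
      rw [h]
      simp only [zero_sub]
      omega
    · have : δ (M - 1) ≤ δ M := hδ (by omega)
      omega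
  have cons : ∀ {x : ℝ[X]} {a : ℕ → ℝ[X]}, x.natDegree ≤ i + 1 + δ M →
      (∀ μ ≤ i, (a μ).natDegree ≤ i - μ + δ (M - 1 - μ)) →
      DegreeBound δ m (i + 1) (consSeq x a) := by
    intro x a hx ha μ hμ
    rcases μ with _ | μ
    · simpa [consSeq, hM] using hx
    · have := ha μ (by omega)
      rw [show M - 1 - (μ : ℤ) = m + 2 * (i + 1 : ℕ) - (μ + 1 : ℕ) by push_cast [hM]; ring] at this
      simpa [consSeq] using this
  have hxy' := fun r hr => (hxy r hr).trans top
  simp only [List.forall_mem_cons] at hxy'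
  exact ⟨(consSeq x a, consSeq y b, s, t), ⟨cons hxy'.1 da', cons hxy'.2.1 db'⟩,
    ha x, hb y, hxy'.2.2.1, hxy'.2.2.2.1, hT⟩

theorem Sminus_subset_slitPlane {ω : ℝ} (hω : ω < 2 * π) : Sminus ω ⊆ slitPlane := fun _ hz =>
  mem_slitPlane_of_abs_arg (by linarith) hz.1 hz.2.le

theorem SplusVar_subset_slitPlane {ω : ℝ} (hω : 0 < ω) : SplusVar ω ⊆ slitPlane := fun _ hz =>
  mem_slitPlane_of_abs_arg (by linarith) hz.1 hz.2.le

theorem logPair_const_zero (m : ℤ) (p : ℝ[X]) (z : ℂ) :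
    logPair m 1 (fun _ => p) (fun _ => 0) z = zpowLog m p z := by
  simp [logPair, logHom_one, zpowLog]

/-- Existence of shadows of all orders `i + 1`, starting from `z^m p₀(log z)`. -/
theorem exists_shadows {ω : ℝ} (hω : ω ∈ Ioo 0 (2 * π)) (m : ℤ) {δ : ℤ → ℕ} (hδ : Monotone δ)
    (hres : 0 ≤ m ∨ δ (-1) + 1 ≤ δ 0) {p₀ : ℝ[X]} (hp₀ : p₀.natDegree ≤ δ m) :
    ∃ v w : ℕ → ℂ → ℂ, v 0 = zpowLog m p₀ ∧ ∀ i : ℕ,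
      (∀ z ∈ Sminus ω, wdz (wdzbar (v (i + 1))) z = v i z) ∧
      (∀ z ∈ SplusVar ω, wdz (wdzbar (w (i + 1))) z = 0) ∧
      (m + 2 * (i + 1 : ℕ) ≠ 0 → ∀ z ∈ Gam ω,
        wdz (v (i + 1)) z + wdz (w (i + 1)) (-z) = 0 ∧
        wdzbar (v (i + 1)) z + wdzbar (w (i + 1)) (-z) = 0) ∧
      (m + 2 * (i + 1 : ℕ) = 0 → ∀ z ∈ Gam ω,
        z * wdz (v (i + 1)) z - conj z * wdzbar (v (i + 1)) z
          - (-z) * wdz (w (i + 1)) (-z) + conj (-z) * wdzbar (w (i + 1)) (-z) = 0 ∧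
        v (i + 1) z = w (i + 1) (-z)) ∧
      SbbPair ω (m + 2 * (i + 1 : ℕ)) (i + 1) (i + 1 + δ (m + 2 * (i + 1 : ℕ)))
        (v (i + 1)) (w (i + 1)) := by
  have hα : ω / 2 ∈ Ioo 0 π := ⟨by linarith [hω.1], by linarith [hω.2]⟩
  obtain ⟨p, q, s, t, hp, hq, hpq, H⟩ := exists_shadow_coeffs hα m hδ hres hp₀
  refine ⟨fun i => logPair (m + 2 * (i : ℕ)) (i + 1) (p i) (q i),
    fun i => logPair (m + 2 * (i : ℕ)) 1 (fun _ => s i) (fun _ => t i), ?_, fun i => ?_⟩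
  · ext z
    simp only [hp, hq]
    simpa using logPair_const_zero m p₀ z
  obtain ⟨h1, h2, hs, ht, hT⟩ := H i
  have hG : ∀ z ∈ Gam ω, z ∈ slitPlane ∧ -z ∈ slitPlane := fun z hz =>
    ⟨mem_slitPlane_of_abs_arg hα.2 hz.1 hz.2.le, neg_mem_slitPlane_of_abs_arg hα hz.1 hz.2⟩
  refine ⟨fun z hz => ?_, fun z hz => ?_, fun hm z hz => ?_, fun hm z hz => ?_, ?_, ?_⟩
  · beta_reduce
    rw [wdz_wdzbar_logPair (Sminus_subset_slitPlane hω.2 hz), h1, h2]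
    push_cast
    ring_nf
  · exact wdz_wdzbar_logPair_one (SplusVar_subset_slitPlane hω.1 hz) _ _ _
  · have hv := hasWirtingerAt_logPair (hG z hz).1 (m + 2 * (i + 1 : ℕ)) (i + 1) (p (i + 1))
      (q (i + 1))
    have hw := hasWirtingerAt_logPair (hG z hz).2 (m + 2 * (i + 1 : ℕ)) 0 (fun _ => s (i + 1))
      (fun _ => t (i + 1))
    rw [hv.wdz, hv.wdzbar, hw.wdz, hw.wdzbar]
    exact (hT z hz.1 hz.2).1 hm
  · have hv := hasWirtingerAt_logPair (hG z hz).1 (m + 2 * (i + 1 : ℕ)) (i + 1) (p (i + 1))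
      (q (i + 1))
    have hw := hasWirtingerAt_logPair (hG z hz).2 (m + 2 * (i + 1 : ℕ)) 0 (fun _ => s (i + 1))
      (fun _ => t (i + 1))
    rw [hv.wdz, hv.wdzbar, hw.wdz, hw.wdzbar]
    exact (hT z hz.1 hz.2).2 hm
  · exact sbbHalf_logPair le_rfl ((hpq (i + 1)).1.le hδ) ((hpq (i + 1)).2.le hδ) _
  · exact sbbHalf_logPair (Nat.zero_le _) (fun _ _ => hs) (fun _ _ => ht) _

theorem HasWirtingerAt.comp_neg {f : ℂ → ℂ} {a b z : ℂ} (h : HasWirtingerAt f a b z) :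
    HasWirtingerAt (fun w => f (-w)) (-a) (-b) (-z) := by
  have h' : HasFDerivAt f (a • (1 : ℂ →L[ℝ] ℂ) + b • (conjCLE : ℂ →L[ℝ] ℂ)) (-(-z)) := by
    rwa [neg_neg]
  refine (h'.comp (-z) (hasFDerivAt_id (𝕜 := ℝ) (-z)).neg).congr_fderiv ?_
  ext v
  simp
  ring

theorem HasWirtingerAt.cexp {f : ℂ → ℂ} {a b z : ℂ} (h : HasWirtingerAt f a b z) :
    HasWirtingerAt (fun w => cexp (f w)) (cexp (f z) * a) (cexp (f z) * b) z := by
  refine ((hasDerivAt_exp (f z)).complexToReal_fderiv.comp z h).congr_fderiv ?_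
  ext v
  simp
  ring

/-- The formal Wirtinger derivative `∂_{z̄}` of `log (-z)` vanishes away from the origin; on the
branch cut this reflects the convention that `fderiv` is zero where the function is not
differentiable. -/
theorem wdzbar_log_neg {z : ℂ} (hz : z ≠ 0) (c : ℂ) : wdzbar (fun w => c * log (-w)) z = 0 := by
  by_cases hd : DifferentiableAt ℝ (fun w => c * log (-w)) z
  · by_cases hc : c = 0
    · simp [hc, wdzbar]
    have hd' : DifferentiableAt ℝ (fun w => log (-w)) z := by
      simpa [hc] using hd.const_mul c⁻¹
    have h1 := hd'.hasWirtingerAt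
    have h2 : HasWirtingerAt (fun w => cexp (log (-w))) (-1) 0 z := by
      refine (hasDerivAt_neg z).hasWirtingerAt.congr_of_eventuallyEq ?_
      filter_upwards [isOpen_ne.mem_nhds hz] with w hw
      rw [exp_log (neg_ne_zero.2 hw)]
    have h3 := h1.cexp.wdzbar.symm.trans h2.wdzbar
    have h4 := (mul_eq_zero.1 h3).resolve_left (exp_ne_zero _)
    rw [((hasDerivAt_const z c).hasWirtingerAt.mul h1).wdzbar, h4]
    simp
  · simp [wdzbar, fderiv_zero_of_not_differentiableAt hd]

/-- The leading coefficient polynomial of the dual shadows. -/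
def dualLeading (k : ℕ) : ℝ[X] :=
  if k = 0 then C (-(1 / (2 * π))) * X else C (1 / (2 * k * π))

theorem zpowLog_dualLeading (k : ℕ) (z : ℂ) : zpowLog (-(k : ℤ)) (dualLeading k) z =
    if k = 0 then -(log z) / (2 * π) else z ^ (-(k : ℤ)) / (2 * k * π) := by
  rw [dualLeading, zpowLog]
  split_ifs with h
  · subst h
    simp
    ring
  · simp
    ring

theorem wdzbar_zpowLog_dualLeading_neg {z : ℂ} (hz : z ≠ 0) (k : ℕ) :
    wdzbar (fun w => zpowLog (-(k : ℤ)) (dualLeading k) (-w)) z = 0 := by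
  by_cases hk : k = 0
  · have : (fun w => zpowLog (-(k : ℤ)) (dualLeading k) (-w)) =
        fun w => -(1 / (2 * π) : ℂ) * log (-w) := by
      ext w
      rw [zpowLog_dualLeading, if_pos hk]
      ring
    rw [this, wdzbar_log_neg hz]
  · have : (fun w => zpowLog (-(k : ℤ)) (dualLeading k) (-w)) =
        fun w : ℂ => (-w) ^ (-(k : ℤ)) / (2 * k * π) := by
      ext w
      rw [zpowLog_dualLeading, if_neg hk]
    rw [this]
    have h := ((hasDerivAt_zpow (-(k : ℤ)) (-z) (Or.inl (neg_ne_zero.2 hz))).comp z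
      (hasDerivAt_neg z)).div_const (2 * k * π : ℂ)
    exact h.hasWirtingerAt.wdzbar

/-- Structure of the primal and dual shadows of any order in complex variables:
the `j`-th primal shadow of `z^k` lies in `𝕊^{k+2j}_{j,j}`, and the `j`-th dual shadow
of `z^{−k}/(2kπ)` (resp. `−log z/(2π)` for `k = 0`) lies in `𝕊^{−k+2j}_{j,j}` if
`−k+2j < 0` and in `𝕊^{−k+2j}_{j,j+1}` if `−k+2j ≥ 0`. -/
theorem stmt7 (ω : ℝ) (hω : ω ∈ Ioo 0 (2 * π)) (k j : ℕ) (hj : 1 ≤ j) :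
    -- (a) primal shadows
    (∃ χ ξ : ℕ → ℂ → ℂ,
      (∀ z, χ 0 z = z ^ k) ∧ (∀ z, ξ 0 z = (-1 : ℂ) ^ k * z ^ k) ∧
      (∀ i, 1 ≤ i → i ≤ j →
        (∀ z ∈ Sminus ω, wdz (wdzbar (χ i)) z = χ (i - 1) z) ∧
        (∀ zp ∈ SplusVar ω, wdz (wdzbar (ξ i)) zp = 0) ∧
        (∀ z ∈ Gam ω, wdz (χ i) z + wdz (ξ i) (-z) = 0 ∧
          wdzbar (χ i) z + wdzbar (ξ i) (-z) = 0)) ∧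
      SbbPair ω ((k : ℤ) + 2 * j) j j (χ j) (ξ j)) ∧
    -- (b) dual shadows
    (∃ zeta eta : ℕ → ℂ → ℂ,
      (∀ z, zeta 0 z =
        (if k = 0 then -(Complex.log z) / (2 * π) else z ^ (-(k : ℤ)) / (2 * k * π))) ∧
      (∀ i, i ≤ j →
        (1 ≤ i → ∀ z ∈ Sminus ω, wdz (wdzbar (zeta i)) z = zeta (i - 1) z) ∧
        (∀ zp ∈ SplusVar ω, wdz (wdzbar (eta i)) zp = 0) ∧
        (-(k : ℤ) + 2 * i ≠ 0 → ∀ z ∈ Gam ω,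
          wdz (zeta i) z + wdz (eta i) (-z) = 0 ∧
          wdzbar (zeta i) z + wdzbar (eta i) (-z) = 0) ∧
        (-(k : ℤ) + 2 * i = 0 → ∀ z ∈ Gam ω,
          z * wdz (zeta i) z - conj z * wdzbar (zeta i) z
            - (-z) * wdz (eta i) (-z) + conj (-z) * wdzbar (eta i) (-z) = 0 ∧
          zeta i z = eta i (-z))) ∧
      (if -(k : ℤ) + 2 * j < 0 then
        SbbPair ω (-(k : ℤ) + 2 * j) j j (zeta j) (eta j)
      else
        SbbPair ω (-(k : ℤ) + 2 * j) j (j + 1) (zeta j) (eta j))) := by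
  have hα : ω / 2 ∈ Ioo 0 π := ⟨by linarith [hω.1], by linarith [hω.2]⟩
  constructor
  · obtain ⟨v, w, hv, H⟩ := exists_shadows hω (k : ℤ) (δ := fun _ => 0) monotone_const
      (Or.inl (by positivity)) (p₀ := 1) (by simp)
    refine ⟨v, fun i => if i = 0 then fun z => (-1 : ℂ) ^ k * z ^ k else w i, ?_, by simp, ?_, ?_⟩
    · intro z
      simp [hv, zpowLog]
    · intro i hi _
      obtain ⟨i, rfl⟩ := Nat.exists_eq_add_of_le' hi
      obtain ⟨h1, h2, h3, -, -⟩ := H i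
      exact ⟨h1, h2, h3 (by positivity)⟩
    · obtain ⟨j, rfl⟩ := Nat.exists_eq_add_of_le' hj
      exact (H j).2.2.2.2
  · obtain ⟨v, w, hv, H⟩ := exists_shadows hω (-(k : ℤ))
      (δ := fun m => if 0 ≤ m then 1 else 0)
      (fun a b hab => by dsimp only; split_ifs <;> omega) (Or.inr (by simp))
      (p₀ := dualLeading k) (by
        rw [dualLeading]
        split_ifs with h1 h2 h2
        · exact (natDegree_C_mul_le _ _).trans natDegree_X_le
        · omega
        all_goals exact (natDegree_C _).le.trans (Nat.zero_le _))
    refine ⟨v, fun i => if i = 0 then fun z => zpowLog (-(k : ℤ)) (dualLeading k) (-z) else w i,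
      fun z => by rw [hv, zpowLog_dualLeading], ?_, ?_⟩
    · rintro (_ | i) hi
      · have hW : ∀ z ∈ Gam ω, ∃ a, HasWirtingerAt (v 0) a 0 z ∧ HasWirtingerAt
            (fun z => zpowLog (-(k : ℤ)) (dualLeading k) (-z)) (-a) 0 (-z) := by
          intro z hz
          have h := (hasDerivAt_zpowLog (mem_slitPlane_of_abs_arg hα.2 hz.1 hz.2.le) (-(k : ℤ))
            (dualLeading k)).hasWirtingerAt
          exact ⟨_, hv ▸ h, h.comp_neg.congr_deriv rfl neg_zero⟩
        simp only [if_true]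
        refine ⟨fun h => absurd h (by simp), fun z hz => ?_, fun _ z hz => ?_, fun _ z hz => ?_⟩
        · have hev : wdzbar (fun w => zpowLog (-(k : ℤ)) (dualLeading k) (-w)) =ᶠ[nhds z]
              fun _ => 0 := by
            filter_upwards [isOpen_ne.mem_nhds hz.1] with w hw
            exact wdzbar_zpowLog_dualLeading_neg hw k
          exact ((hasDerivAt_const z (0 : ℂ)).hasWirtingerAt.congr_of_eventuallyEq hev).wdz
        · obtain ⟨a, h1, h2⟩ := hW z hz
          rw [h1.wdz, h1.wdzbar, h2.wdz, h2.wdzbar]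
          simp
        · obtain ⟨a, h1, h2⟩ := hW z hz
          rw [h1.wdz, h1.wdzbar, h2.wdz, h2.wdzbar]
          simp [hv]
      · obtain ⟨h1, h2, h3, h4, -⟩ := H i
        exact ⟨fun _ => h1, h2, h3, h4⟩
    · obtain ⟨j, rfl⟩ := Nat.exists_eq_add_of_le' hj
      have h := (H j).2.2.2.2
      split_ifs with hlt
      · rw [if_neg (not_le.2 hlt)] at h
        exact h
      · rw [if_pos (not_lt.1 hlt)] at h
        exact h
end
end

section
/- Fix ω ∈ (0,2π) and k ∈ ℤ∖{−1,−2}. Define, for z in the closed sector |arg z| ≤ ω/2 minus the origin, v^k(z) = (sin ω/(π(k+2))) z^{k+2} log z + (sin((k+1)ω)/(π(k+1)(k+2))) z̄^{k+2} log z̄ − (cos ω/(k+2)) z^{k+2} + z^{k+1} z̄/(k+1), and, for z₊ in the closed sector |arg z₊| ≤ π − ω/2 minus the origin, w^k(z₊) = (−1)^k [ (sin ω/(π(k+2))) z₊^{k+2} log z₊ + (sin((k+1)ω)/(π(k+1)(k+2))) z̄₊^{k+2} log z̄₊ + (cos((k+1)ω)/((k+1)(k+2))) z̄₊^{k+2}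 ]. Then the pair (v^k, w^k) solves the transmission problem: ∂_z∂_{z̄} v^k(z) = z^k for all z ∈ S₋; ∂_{z₊}∂_{z̄₊} w^k(z₊) = 0 for all z₊ with |arg z₊| < π − ω/2; and for all z ∈ Γ, ∂_z v^k(z) + (∂_{z₊} w^k)(−z) = 0 and ∂_{z̄} v^k(z) + (∂_{z̄₊} w^k)(−z) = 0. -/
open Complex ComplexConjugate Filter Set
open scoped Real

noncomputable section

/-- The Wirtinger derivatives of `F z + G z̄ + H z * z̄` with `F`, `G`, `H` holomorphic. -/
theorem wdz_wdzbar_of_hasDerivAt {f F G H : ℂ → ℂ} {F' G' H' z : ℂ}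
    (hf : ∀ z, f z = F z + G (conj z) + H z * conj z)
    (hF : HasDerivAt F F' z) (hG : HasDerivAt G G' (conj z)) (hH : HasDerivAt H H' z) :
    wdz f z = F' + H' * conj z ∧ wdzbar f z = G' + H z := by
  have hc : HasFDerivAt (fun z : ℂ => conj z) (conjCLE : ℂ →L[ℝ] ℂ) z :=
    (conjCLE : ℂ →L[ℝ] ℂ).hasFDerivAt
  have hF' := hF.hasFDerivAt.restrictScalars ℝ
  have hH' := hH.hasFDerivAt.restrictScalars ℝ
  have hG' : HasFDerivAt (fun z => G (conj z)) _ z :=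
    (hG.hasFDerivAt.restrictScalars ℝ).comp z hc
  have h := (hF'.add hG').add (hH'.mul hc)
  have hfun : f = (F + fun z => G (conj z)) + H * fun z => conj z := by
    funext z
    simpa using hf z
  unfold wdz wdzbar
  rw [hfun, h.fderiv]
  constructor <;> simp <;> ring_nf <;> simp only [I_sq] <;> ring

theorem Filter.EventuallyEq.wdz_eq {f g : ℂ → ℂ} {z : ℂ} (h : f =ᶠ[nhds z] g) :
    wdz f z = wdz g z := by
  unfold wdz
  rw [h.fderiv_eq]

theorem hasDerivAt_zpow_mul_log (n : ℤ) {z : ℂ} (hz : z ∈ slitPlane) :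
    HasDerivAt (fun z => z ^ n * Complex.log z)
      (n * z ^ (n - 1) * Complex.log z + z ^ (n - 1)) z := by
  have hz0 := slitPlane_ne_zero hz
  refine ((hasDerivAt_zpow n z (Or.inl hz0)).mul (hasDerivAt_log hz)).congr_deriv ?_
  rw [zpow_sub_one₀ hz0]

theorem conj_mem_slitPlane {z : ℂ} (hz : z ∈ slitPlane) : conj z ∈ slitPlane := by
  simpa [mem_slitPlane_iff] using hz

theorem mem_slitPlane_of_abs_arg_lt {z : ℂ} (h0 : z ≠ 0) (h : |z.arg| < π) :
    z ∈ slitPlane :=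
  mem_slitPlane_iff_arg.2 ⟨fun e => by rw [e, abs_of_pos Real.pi_pos] at h; exact h.false, h0⟩

/-- On the ray at angle `sω/2` with `s = ±1`, the branches of the logarithm at `z` and `-z`
differ by `s i π`, and `z = e^{s i ω} z̄`. -/
theorem exists_sign_of_mem_Gam {ω : ℝ} (hω : ω ∈ Ioo 0 (2 * π)) {z : ℂ} (hz : z ∈ Gam ω) :
    ∃ s : ℝ, (s = 1 ∨ s = -1) ∧ z ∈ slitPlane ∧ -z ∈ slitPlane ∧
      Complex.log (-z) = Complex.log z - s * I * π ∧
      Complex.log (conj (-z)) = Complex.log (conj z) + s * I * π ∧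
      z = Complex.exp (s * ω * I) * conj z := by
  obtain ⟨h0, harg⟩ := hz
  obtain ⟨hω0, hω1⟩ := hω
  have hsl : z ∈ slitPlane := mem_slitPlane_of_abs_arg_lt h0 (by linarith)
  have polar : ∀ s : ℝ, z.arg = s * (ω / 2) → z = Complex.exp (s * ω * I) * conj z := by
    intro s hs
    have h1 : z = ‖z‖ * Complex.exp (z.arg * I) := (norm_mul_exp_arg_mul_I z).symm
    have h2 : conj z = ‖z‖ * Complex.exp (-(z.arg * I)) := by
      conv_lhs => rw [h1]
      rw [map_mul, ← exp_conj]
      simp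
    rw [h2]
    conv_lhs => rw [h1]
    rw [mul_left_comm, ← Complex.exp_add, hs]
    congr 2
    push_cast
    ring
  rcases (abs_eq (by linarith)).1 harg with h | h
  · have him : 0 < z.im := by
      rw [← norm_mul_sin_arg z, h]
      exact mul_pos (norm_pos_iff.2 h0) (Real.sin_pos_of_pos_of_lt_pi (by linarith) (by linarith))
    have hlog : Complex.log (-z) = Complex.log z - (1 : ℝ) * I * π := by
      simp only [Complex.log, norm_neg, arg_neg_eq_arg_sub_pi_of_im_pos him]
      push_cast
      ring
    have hsl' : -z ∈ slitPlane := Or.inr (by simpa using him.ne')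
    refine ⟨1, Or.inl rfl, hsl, hsl', hlog, ?_, polar 1 (by linarith)⟩
    rw [log_conj _ (slitPlane_arg_ne_pi hsl'), log_conj _ (slitPlane_arg_ne_pi hsl), hlog]
    simp
  · have him : z.im < 0 := by
      rw [← norm_mul_sin_arg z, h, Real.sin_neg]
      have := mul_pos (norm_pos_iff.2 h0)
        (Real.sin_pos_of_pos_of_lt_pi (x := ω / 2) (by linarith) (by linarith))
      linarith
    have hlog : Complex.log (-z) = Complex.log z - (-1 : ℝ) * I * π := by
      simp only [Complex.log, norm_neg, arg_neg_eq_arg_add_pi_of_im_neg him]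
      push_cast
      ring
    have hsl' : -z ∈ slitPlane := Or.inr (by simpa using him.ne)
    refine ⟨-1, Or.inr rfl, hsl, hsl', hlog, ?_, polar (-1) (by linarith)⟩
    rw [log_conj _ (slitPlane_arg_ne_pi hsl'), log_conj _ (slitPlane_arg_ne_pi hsl), hlog]
    simp

/-- Euler's formula for an angle multiplied by a sign. -/
theorem exp_sign_mul_I {s : ℝ} (hs : s = 1 ∨ s = -1) (x : ℝ) :
    Complex.exp (s * x * I) = Real.cos x + s * Real.sin x * I := by
  rw [← ofReal_mul, exp_mul_I, ← ofReal_cos, ← ofReal_sin]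
  rcases hs with rfl | rfl <;> simp

/-- The first-order shadow generated by `z^k`, `k ∈ ℤ∖{−1,−2}`
(Proposition `prop:kneq-1-2`). -/
theorem stmt10 (ω : ℝ) (hω : ω ∈ Ioo 0 (2 * π)) (k : ℤ) (hk1 : k ≠ -1) (hk2 : k ≠ -2)
    (v w : ℂ → ℂ)
    (hv : ∀ z : ℂ, v z =
      ((Real.sin ω : ℂ) / (π * ((k : ℂ) + 2))) * z ^ (k + 2) * Complex.log z
      + ((Real.sin (((k : ℝ) + 1) * ω) : ℂ) / (π * ((k : ℂ) + 1) * ((k : ℂ) + 2)))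
          * (conj z) ^ (k + 2) * Complex.log (conj z)
      - ((Real.cos ω : ℂ) / ((k : ℂ) + 2)) * z ^ (k + 2)
      + z ^ (k + 1) * conj z / ((k : ℂ) + 1))
    (hw : ∀ z : ℂ, w z = (-1 : ℂ) ^ k *
      (((Real.sin ω : ℂ) / (π * ((k : ℂ) + 2))) * z ^ (k + 2) * Complex.log z
      + ((Real.sin (((k : ℝ) + 1) * ω) : ℂ) / (π * ((k : ℂ) + 1) * ((k : ℂ) + 2)))
          * (conj z) ^ (k + 2) * Complex.log (conj z)
      + ((Real.cos (((k : ℝ) + 1) * ω) : ℂ) / (((k : ℂ) + 1) * ((k : ℂ) + 2)))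
          * (conj z) ^ (k + 2))) :
    (∀ z ∈ Sminus ω, wdz (wdzbar v) z = z ^ k) ∧
    (∀ zp ∈ SplusVar ω, wdz (wdzbar w) zp = 0) ∧
    (∀ z ∈ Gam ω, wdz v z + wdz w (-z) = 0 ∧ wdzbar v z + wdzbar w (-z) = 0) := by
  obtain ⟨hω0, hω1⟩ := hω
  have hk1' : (k : ℂ) + 1 ≠ 0 := by exact_mod_cast fun h : k + 1 = 0 => hk1 (by lia)
  have hk2' : (k : ℂ) + 2 ≠ 0 := by exact_mod_cast fun h : k + 2 = 0 => hk2 (by lia)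
  have hπ : (π : ℂ) ≠ 0 := ofReal_ne_zero.2 Real.pi_ne_zero
  set A : ℂ := (Real.sin ω : ℂ) / (π * ((k : ℂ) + 2)) with hA
  set B : ℂ := (Real.sin (((k : ℝ) + 1) * ω) : ℂ) / (π * ((k : ℂ) + 1) * ((k : ℂ) + 2)) with hB
  set C : ℂ := (Real.cos ω : ℂ) / ((k : ℂ) + 2) with hC
  set D : ℂ := (Real.cos (((k : ℝ) + 1) * ω) : ℂ) / (((k : ℂ) + 1) * ((k : ℂ) + 2)) with hD
  have dpow : ∀ z ∈ slitPlane, HasDerivAt (fun z : ℂ => z ^ (k + 2))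
      (((k : ℂ) + 2) * z ^ (k + 1)) z := fun z hz => by
    refine (hasDerivAt_zpow (k + 2) z (Or.inl (slitPlane_ne_zero hz))).congr_deriv ?_
    rw [show k + 2 - 1 = k + 1 by ring]
    push_cast
    ring
  have dlog : ∀ z ∈ slitPlane, HasDerivAt (fun z : ℂ => z ^ (k + 2) * Complex.log z)
      (((k : ℂ) + 2) * z ^ (k + 1) * Complex.log z + z ^ (k + 1)) z := fun z hz => by
    refine (hasDerivAt_zpow_mul_log (k + 2) hz).congr_deriv ?_
    rw [show k + 2 - 1 = k + 1 by ring]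
    push_cast
    ring
  have dpow' : ∀ z ∈ slitPlane, HasDerivAt (fun z : ℂ => z ^ (k + 1) / ((k : ℂ) + 1))
      (z ^ k) z := fun z hz => by
    refine ((hasDerivAt_zpow (k + 1) z (Or.inl (slitPlane_ne_zero hz))).div_const
      ((k : ℂ) + 1)).congr_deriv ?_
    rw [show k + 1 - 1 = k by ring]
    push_cast
    field_simp
  have dG : ∀ (b d : ℂ), ∀ z ∈ slitPlane, HasDerivAt
      (fun z : ℂ => b * (z ^ (k + 2) * Complex.log z) + d * z ^ (k + 2))
      (b * (((k : ℂ) + 2) * z ^ (k + 1) * Complex.log z + z ^ (k + 1))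
        + d * (((k : ℂ) + 2) * z ^ (k + 1))) z :=
    fun b d z hz => ((dlog z hz).const_mul b).add ((dpow z hz).const_mul d)
  have dG' : ∀ (b d : ℂ), ∀ z ∈ slitPlane, DifferentiableAt ℂ
      (fun z : ℂ => b * (((k : ℂ) + 2) * z ^ (k + 1) * Complex.log z + z ^ (k + 1))
        + d * (((k : ℂ) + 2) * z ^ (k + 1))) z := fun b d z hz => by
    have h1 : DifferentiableAt ℂ (fun z : ℂ => z ^ (k + 1)) z :=
      differentiableAt_zpow.2 (Or.inl (slitPlane_ne_zero hz))
    have h2 : DifferentiableAt ℂ Complex.log z := differentiableAt_log hz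
    fun_prop
  have wv : ∀ z ∈ slitPlane, _ := fun z hz => wdz_wdzbar_of_hasDerivAt (f := v) (z := z)
    (fun z => by rw [hv z]; ring) (dG A (-C) z hz) (dG B 0 _ (conj_mem_slitPlane hz))
    (dpow' z hz)
  have ww : ∀ z ∈ slitPlane, _ := fun z hz => wdz_wdzbar_of_hasDerivAt (f := w) (z := z)
    (fun z => by rw [hw z]; simp only [zero_mul]; ring) (dG ((-1) ^ k * A) 0 z hz)
    (dG ((-1) ^ k * B) ((-1) ^ k * D) _ (conj_mem_slitPlane hz))
    (hasDerivAt_const z (0 : ℂ))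
  refine ⟨fun z hz => ?_, fun z hz => ?_, fun z hz => ?_⟩
  · have hz' : z ∈ slitPlane := mem_slitPlane_of_abs_arg_lt hz.1 (by linarith [hz.2])
    have he := (isOpen_slitPlane.eventually_mem hz').mono fun y hy => (wv y hy).2
    rw [Filter.EventuallyEq.wdz_eq he]
    refine (wdz_wdzbar_of_hasDerivAt (fun y => ?_) (dpow' z hz')
      (dG' B 0 _ (conj_mem_slitPlane hz')).hasDerivAt
      (hasDerivAt_const z (0 : ℂ))).1.trans ?_ <;> ring
  · have hz' : z ∈ slitPlane := mem_slitPlane_of_abs_arg_lt hz.1 (by linarith [hz.2])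
    have he := (isOpen_slitPlane.eventually_mem hz').mono fun y hy => (ww y hy).2
    rw [Filter.EventuallyEq.wdz_eq he]
    refine (wdz_wdzbar_of_hasDerivAt (fun y => ?_) (hasDerivAt_const z (0 : ℂ))
      (dG' ((-1) ^ k * B) ((-1) ^ k * D) _ (conj_mem_slitPlane hz')).hasDerivAt
      (hasDerivAt_const z (0 : ℂ))).1.trans ?_ <;> ring
  · obtain ⟨s, hs, hz1, hz2, hl1, hl2, hp⟩ := exists_sign_of_mem_Gam ⟨hω0, hω1⟩ hz
    have hz0 : z ≠ 0 := hz.1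
    have hpow : ∀ y : ℂ, (-1 : ℂ) ^ k * (-y) ^ (k + 1) = -y ^ (k + 1) := fun y => by
      rw [← neg_one_mul y, mul_zpow, ← mul_assoc, ← zpow_add₀ (by norm_num), ← add_assoc,
        Odd.neg_one_zpow ⟨k, by ring⟩, neg_one_mul]
    have hs2 : (s : ℂ) ^ 2 = 1 := by rcases hs with rfl | rfl <;> simp
    have he1 := exp_sign_mul_I hs ω
    have he2 := exp_sign_mul_I hs (((k : ℝ) + 1) * ω)
    have hAA : A * ((k : ℂ) + 2) * π = Real.sin ω := by rw [hA]; field_simp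
    have hCC : C * ((k : ℂ) + 2) = Real.cos ω := by rw [hC]; field_simp
    have hBB : B * ((k : ℂ) + 2) * π = Real.sin (((k : ℝ) + 1) * ω) / ((k : ℂ) + 1) := by
      rw [hB]; field_simp
    have hDD : D * ((k : ℂ) + 2) = Real.cos (((k : ℝ) + 1) * ω) / ((k : ℂ) + 1) := by
      rw [hD]; field_simp
    have hp1 : conj z = (Real.cos ω - s * Real.sin ω * I) * z := by
      have hcs : (Real.cos ω : ℂ) ^ 2 + (Real.sin ω : ℂ) ^ 2 = 1 := by
        exact_mod_cast Real.cos_sq_add_sin_sq ω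
      have hone : (Real.cos ω - s * Real.sin ω * I) * Complex.exp (s * ω * I) = 1 := by
        rw [he1]
        linear_combination hcs + (Real.sin ω : ℂ) ^ 2 * hs2
          - (s : ℂ) ^ 2 * (Real.sin ω : ℂ) ^ 2 * I_sq
      calc conj z = (Real.cos ω - s * Real.sin ω * I) * Complex.exp (s * ω * I) * conj z := by
            rw [hone, one_mul]
        _ = _ := by rw [mul_assoc, ← hp]
    have hp2 : z ^ (k + 1) = (Real.cos (((k : ℝ) + 1) * ω)
        + s * Real.sin (((k : ℝ) + 1) * ω) * I) * conj z ^ (k + 1) := by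
      rw [← he2]
      conv_lhs => rw [hp]
      rw [mul_zpow, ← Complex.exp_int_mul]
      congr 2
      push_cast
      ring
    rw [(wv z hz1).1, (wv z hz1).2, (ww _ hz2).1, (ww _ hz2).2]
    constructor
    · have hzk : z ^ (k + 1) = z ^ k * z := zpow_add_one₀ hz0 k
      have h := hpow z
      rw [hl1]
      linear_combination (A * ((k + 2) * (Complex.log z - s * I * π) + 1)) * h
        + z ^ (k + 1) * s * I * hAA - z ^ (k + 1) * hCC + z ^ k * hp1
        - (Real.cos ω - s * Real.sin ω * I) * hzk
    · have h := hpow (conj z)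
      rw [hl2, map_neg]
      linear_combination (B * ((k + 2) * (Complex.log (conj z) + s * I * π) + 1)
          + D * (k + 2)) * h
        - conj z ^ (k + 1) * s * I * hBB - conj z ^ (k + 1) * hDD + hp2 / (k + 1)
end
end
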